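/- Let d ≥ 1, 0 < p, q, r ≤ ∞, and let s(·) : Ω → (0,∞) be log-Hölder continuous with s_min := min_Ω s(·) > d(1/p − 1/r)_+. Then for every ε > 0 there exists a constant C_ε > 0 such that for all N ∈ ℕ, N ≥ 1: ρ_N(U_{B_{p,q}^{s(x)}(Ω)})_{L^r(Ω)} ≥ C_ε N^{−(s_min+ε)/d}, where ρ_N(W)_{L^r(Ω)} is the infimum, over all sets B of measurable functions on Ω of pseudo-dimension at most N, of sup_{f ∈ W} inf_{φ ∈ B} ‖f − φ‖_{L^r(Ω)}. -/

import Mathlib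

open MeasureTheory
open scoped ENNReal NNReal Classical

noncomputable section

abbrev Euc (d : ℕ) : Type := EuclideanSpace ℝ (Fin d)

/-- The unit cube `Ω = [0,1]^d`. -/
def unitCube (d : ℕ) : Set (Euc d) := {x | ∀ i, x i ∈ Set.Icc (0 : ℝ) 1}

/-- The axis-aligned cube `[c - t, c + t]^d`. -/
def cubeAt {d : ℕ} (c : Euc d) (t : ℝ) : Set (Euc d) := {x | ∀ i, |x i - c i| ≤ t}

/-- Lebesgue measure restricted to the unit cube `Ω`. -/
def cubeMeasure (d : ℕ) : Measure (Euc d) := volume.restrict (unitCube d)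

/-- `r`-th difference `Δ_h^r f (x) = Σ_{j=0}^r (−1)^{r−j} C(r,j) f(x+jh)`, set to `0`
unless both `x ∈ Ω` and `x + r h ∈ Ω`. -/
def rDiff {d : ℕ} (r : ℕ) (h : Euc d) (f : Euc d → ℝ) (x : Euc d) : ℝ :=
  if x ∈ unitCube d ∧ x + (r : ℝ) • h ∈ unitCube d then
    ∑ j ∈ Finset.range (r + 1), (-1 : ℝ) ^ (r - j) * (r.choose j : ℝ) * f (x + (j : ℝ) • h)
  else 0

/-- `ω*_{r,p}(f,t) = sup_{‖h‖₂ ≤ t} ‖ t^{−s(·)} Δ_h^r f ‖_{L^p(Ω)}`. -/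
def omegaStar {d : ℕ} (p : ℝ≥0∞) (σ : Euc d → ℝ) (r : ℕ) (f : Euc d → ℝ) (t : ℝ) : ℝ≥0∞ :=
  ⨆ h ∈ {h : Euc d | ‖h‖ ≤ t},
    eLpNorm (fun x => t ^ (-(σ x)) * rDiff r h f x) p (cubeMeasure d)

/-- Variable-exponent Besov seminorm `|f|_{B^{s(x)}_{p,q}(Ω)}` (difference order `r`):
`(∫_0^1 ω*_{r,p}(f,t)^q dt/t)^{1/q}` for `q < ∞`, and `sup_{t>0} ω*_{r,p}(f,t)` for `q = ∞`. -/
def vBesovSemi {d : ℕ} (p q : ℝ≥0∞) (σ : Euc d → ℝ) (r : ℕ) (f : Euc d → ℝ) : ℝ≥0∞ :=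
  if q = ∞ then ⨆ t ∈ Set.Ioi (0 : ℝ), omegaStar p σ r f t
  else (∫⁻ t in Set.Ioo (0 : ℝ) 1,
        (omegaStar p σ r f t) ^ q.toReal * ENNReal.ofReal (1 / t)) ^ (1 / q.toReal)

/-- Variable-exponent Besov (quasi-)norm with explicit difference order `r`:
`‖f‖ = ‖f‖_{L^p(Ω)} + |f|_{B^{s(x)}_{p,q}(Ω)}`. -/
def vBesovNormR {d : ℕ} (p q : ℝ≥0∞) (σ : Euc d → ℝ) (r : ℕ) (f : Euc d → ℝ) : ℝ≥0∞ :=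
  eLpNorm f p (cubeMeasure d) + vBesovSemi p q σ r f

/-- The canonical difference order `r = ⌊sup_Ω s(·)⌋ + 1`. -/
def besovR {d : ℕ} (σ : Euc d → ℝ) : ℕ := ⌊sSup (σ '' unitCube d)⌋₊ + 1

/-- Variable-exponent Besov (quasi-)norm `‖f‖_{B^{s(x)}_{p,q}(Ω)}` with the canonical
difference order `r = ⌊sup_Ω s(·)⌋ + 1`. -/
def vBesovNorm {d : ℕ} (p q : ℝ≥0∞) (σ : Euc d → ℝ) (f : Euc d → ℝ) : ℝ≥0∞ :=
  vBesovNormR p q σ (besovR σ) f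

/-- The unit ball `U_{B^{s(x)}_{p,q}(Ω)}`. -/
def vBesovUnitBall (d : ℕ) (p q : ℝ≥0∞) (σ : Euc d → ℝ) : Set (Euc d → ℝ) :=
  {f | vBesovNorm p q σ f ≤ 1}

/-- log-Hölder continuity on the unit cube: there exists `c_log > 0` with
`|σ x − σ y| ≤ c_log / log (e + 1/‖x−y‖₂)` for all `x ≠ y` in `Ω`. -/
def LogHolder {d : ℕ} (σ : Euc d → ℝ) : Prop :=
  ∃ c : ℝ, 0 < c ∧ ∀ x ∈ unitCube d, ∀ y ∈ unitCube d, x ≠ y →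
    |σ x - σ y| ≤ c / Real.log (Real.exp 1 + 1 / ‖x - y‖)

/-- Univariate cardinal B-spline of degree `m`. -/
def bspline (m : ℕ) (x : ℝ) : ℝ :=
  (m.factorial : ℝ)⁻¹ *
    ∑ j ∈ Finset.range (m + 2), (-1 : ℝ) ^ j * ((m + 1).choose j : ℝ) * max (x - j) 0 ^ m

/-- Tensor-product cardinal B-spline `M_{k,j}^d(x) = M_{0,0}^d(2^k x − j)`. -/
def Mspline (d m : ℕ) (k : ℕ) (j : Fin d → ℤ) (x : Euc d) : ℝ :=
  ∏ i, bspline m ((2 : ℝ) ^ k * x i - (j i : ℝ))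

/-- A family `B` of real-valued functions pseudo-shatters `n` points of `D`: there are
`a_1,…,a_n ∈ D` and `b_1,…,b_n ∈ ℝ` realizing all `2^n` sign patterns of
`(sgn(f(a_1)+b_1),…,sgn(f(a_n)+b_n))`, `f ∈ B`. -/
def PseudoShattersOn {d : ℕ} (D : Set (Euc d)) (B : Set (Euc d → ℝ)) (n : ℕ) : Prop :=
  ∃ a : Fin n → Euc d, (∀ i, a i ∈ D) ∧ ∃ b : Fin n → ℝ,
    ∀ v : Fin n → Bool, ∃ f ∈ B, ∀ i, (0 < f (a i) + b i ↔ v i = true)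


theorem rl_count_small {ι : Type} [Fintype ι] :
    (((Finset.univ : Finset (Finset ι)).filter (fun e => 16 * e.card ≤ Fintype.card ι)).card) ^ 16
      ≤ 53 ^ Fintype.card ι := by
  set M := Fintype.card ι with hM
  set X := (Finset.univ : Finset (Finset ι)).filter (fun e => 16 * e.card ≤ M) with hX
  have h1 : ∑ e : Finset ι, (1/8 : ℝ) ^ e.card = (9/8 : ℝ) ^ M := by
    have := Fintype.sum_pow_mul_eq_add_pow ι (1/8 : ℝ) 1
    simp only [one_pow, mul_one] at this
    rw [this]; norm_num [hM]
  have h2 : (X.card : ℝ) * (1/8 : ℝ) ^ (M / 16) ≤ (9/8 : ℝ) ^ M := by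
    rw [← h1, ← nsmul_eq_mul]
    refine le_trans (Finset.card_nsmul_le_sum X (fun e => (1/8 : ℝ) ^ e.card) _ ?_) ?_
    · intro e he
      rw [hX, Finset.mem_filter] at he
      exact pow_le_pow_of_le_one (by norm_num) (by norm_num) (by omega)
    · exact Finset.sum_le_sum_of_subset_of_nonneg (Finset.subset_univ _)
        (fun _ _ _ => by positivity)
  have h3 : (X.card : ℝ) ≤ 8 ^ (M/16) * (9/8 : ℝ) ^ M := by
    rw [one_div, inv_pow] at h2
    rwa [← div_eq_mul_inv, div_le_iff₀ (by positivity), mul_comm] at h2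
  have h4 : ((X.card : ℝ)) ^ 16 ≤ 53 ^ M := by
    calc ((X.card : ℝ)) ^ 16 ≤ (8 ^ (M/16) * (9/8 : ℝ) ^ M) ^ 16 := by gcongr
      _ = 8 ^ (M/16*16) * (9/8 : ℝ) ^ (16 * M) := by
          rw [mul_pow, ← pow_mul, ← pow_mul, mul_comm M 16]
      _ ≤ 8 ^ M * (9/8 : ℝ) ^ (16 * M) := by
          gcongr
          · norm_num
          · omega
      _ = (8 * (9/8 : ℝ) ^ 16) ^ M := by rw [mul_pow, ← pow_mul]
      _ ≤ 53 ^ M := by gcongr; norm_num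
  exact_mod_cast h4

theorem rl_comb {ι : Type} [Fintype ι] (N : ℕ) (hM : 16 ≤ Fintype.card ι)
    (hN : 16 * N ≤ Fintype.card ι) (P : Finset ι → Finset ι)
    (hP : 32 * ∑ θ : Finset ι, (symmDiff θ (P θ)).card ≤ 2 ^ Fintype.card ι * Fintype.card ι) :
    ∃ s : Finset ι, s.card = N + 1 ∧ (Finset.univ.image P).Shatters s := by
  set M := Fintype.card ι with hMd
  by_contra hcon
  push Not at hcon
  set X := (Finset.univ : Finset (Finset ι)).filter (fun e => 16 * e.card ≤ M) with hX
  set A := Finset.univ.image P with hA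
  have hAX : A.card ≤ X.card := by
    refine (Finset.card_le_card_shatterer A).trans (Finset.card_le_card ?_)
    intro s hs
    rw [Finset.mem_shatterer] at hs
    rw [hX, Finset.mem_filter]
    refine ⟨Finset.mem_univ _, ?_⟩
    by_contra hlt
    have : N + 1 ≤ s.card := by omega
    obtain ⟨t, hts, htc⟩ := Finset.exists_subset_card_eq this
    exact hcon t htc (hs.mono_right hts)
  set G := (Finset.univ : Finset (Finset ι)).filter
    (fun θ => 16 * (symmDiff θ (P θ)).card ≤ M) with hG
  set Gc := (Finset.univ : Finset (Finset ι)).filter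
    (fun θ => ¬ 16 * (symmDiff θ (P θ)).card ≤ M) with hGc
  have hsum : G.card + Gc.card = 2 ^ M := by
    rw [hG, hGc, Finset.card_filter_add_card_filter_not]
    simp [hMd]
  have hGcb : Gc.card * M ≤ 16 * ∑ θ : Finset ι, (symmDiff θ (P θ)).card := by
    rw [Finset.mul_sum, ← smul_eq_mul]
    refine le_trans (Finset.card_nsmul_le_sum Gc (fun θ => 16 * (symmDiff θ (P θ)).card) _ ?_) ?_
    · intro θ hθ
      rw [hGc, Finset.mem_filter] at hθ
      omega
    · exact Finset.sum_le_sum_of_subset (Finset.subset_univ _)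
  have hGc2 : 2 * Gc.card ≤ 2 ^ M := by
    have : (2 * Gc.card) * M ≤ 2 ^ M * M := by nlinarith
    exact Nat.le_of_mul_le_mul_right this (by omega)
  have hGX : G.card ≤ X.card * X.card := by
    calc G.card ≤ (A ×ˢ X).card := by
          refine Finset.card_le_card_of_injOn (fun θ => (P θ, symmDiff θ (P θ))) ?_ ?_
          · intro θ hθ
            have hθ' := (Finset.mem_filter.1 (Finset.mem_coe.1 hθ)).2
            simp only [Finset.coe_product, Set.mem_prod, Finset.mem_coe]
            exact ⟨Finset.mem_image_of_mem _ (Finset.mem_univ _),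
              Finset.mem_filter.2 ⟨Finset.mem_univ _, hθ'⟩⟩
          · intro θ _ θ' _ h
            simp only [Prod.mk.injEq] at h
            have h2 := h.2
            rw [h.1] at h2
            exact symmDiff_left_injective _ h2
      _ = A.card * X.card := Finset.card_product _ _
      _ ≤ X.card * X.card := Nat.mul_le_mul_right _ hAX
  have h1 : 2 ^ M ≤ 2 * (X.card * X.card) := by omega
  have h2 : (2 ^ M) ^ 16 ≤ 65536 * (53 ^ M * 53 ^ M) := by
    calc (2 ^ M) ^ 16 ≤ (2 * (X.card * X.card)) ^ 16 := Nat.pow_le_pow_left h1 _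
      _ = 65536 * (X.card ^ 16 * X.card ^ 16) := by ring
      _ ≤ _ := by
        have := rl_count_small (ι := ι)
        exact Nat.mul_le_mul_left _ (Nat.mul_le_mul this this)
  have h3 : (2 ^ M) ^ 16 = 65536 ^ M := by
    rw [← pow_mul, mul_comm, pow_mul]; norm_num
  have h4 : (53 ^ M * 53 ^ M) = 2809 ^ M := by rw [← mul_pow]; norm_num
  rw [h3, h4] at h2
  have h5 : (23 * 2809) ^ M ≤ 65536 ^ M := Nat.pow_le_pow_left (by norm_num) _
  rw [mul_pow] at h5
  have h6 : (23:ℕ) ^ 16 ≤ 23 ^ M := Nat.pow_le_pow_right (by norm_num) hM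
  have h7 : 23 ^ M * 2809 ^ M ≤ 65536 * 2809 ^ M := h5.trans h2
  have h8 := Nat.le_of_mul_le_mul_right h7 (by positivity)
  norm_num at h6
  omega

theorem rl_fwdDiff_bound {E : Type} [NormedAddCommGroup E] [NormedSpace ℝ E] (R : ℕ) :
    ∀ (F : Type) [NormedAddCommGroup F] [NormedSpace ℝ F] (Φ : E → F),
      ContDiff ℝ (⊤ : ℕ∞) Φ → HasCompactSupport Φ →
      ∃ C : ℝ, 0 ≤ C ∧ ∀ x h : E, ‖(fwdDiff h)^[R] Φ x‖ ≤ C * ‖h‖ ^ R := by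
  induction R with
  | zero =>
    intro F _ _ Φ hΦ hs
    obtain ⟨C, hC⟩ := hs.exists_bound_of_continuous hΦ.continuous
    refine ⟨C, (norm_nonneg _).trans (hC 0), fun x h => by simpa using hC x⟩
  | succ R ih =>
    intro F _ _ Φ hΦ hs
    obtain ⟨C, hC0, hC⟩ := ih (E →L[ℝ] F) (fderiv ℝ Φ)
      (hΦ.fderiv_right (by simp)) (hs.fderiv ℝ)
    refine ⟨C, hC0, fun x h => ?_⟩
    have hd : ∀ y, HasFDerivAt ((fwdDiff h)^[R] Φ) ((fwdDiff h)^[R] (fderiv ℝ Φ) y) y := by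
      intro y
      have e1 : (fwdDiff h)^[R] Φ = fun y => ∑ k ∈ Finset.range (R + 1),
          ((-1 : ℤ) ^ (R - k) * R.choose k) • Φ (y + k • h) := by
        funext y; exact fwdDiff_iter_eq_sum_shift h Φ R y
      rw [e1, fwdDiff_iter_eq_sum_shift h (fderiv ℝ Φ) R y]
      refine HasFDerivAt.fun_sum fun k _ => ?_
      have hd0 : HasFDerivAt (fun y => Φ (y + k • h)) (fderiv ℝ Φ (y + k • h)) y := by
        rw [hasFDerivAt_comp_add_right]
        exact ((hΦ.differentiable (by simp)) _).hasFDerivAt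
      simp only [← Int.cast_smul_eq_zsmul ℝ]
      exact
        hd0.const_smul ((((-1 : ℤ) ^ (R - k) * R.choose k : ℤ)) : ℝ)
    rw [Function.iterate_succ_apply', fwdDiff]
    have := Convex.norm_image_sub_le_of_norm_hasFDerivWithin_le (s := Set.univ)
      (f := (fwdDiff h)^[R] Φ) (fun y _ => (hd y).hasFDerivWithinAt)
      (fun y _ => hC y h) convex_univ (Set.mem_univ x) (Set.mem_univ (x + h))
    simpa [pow_succ, mul_assoc] using this

/-- The plain `R`-th difference, without the cut-off at the boundary of the cube. -/
def rlD {d : ℕ} (R : ℕ) (h : Euc d) (f : Euc d → ℝ) (x : Euc d) : ℝ :=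
  ∑ j ∈ Finset.range (R + 1), (-1 : ℝ) ^ (R - j) * (R.choose j : ℝ) * f (x + (j : ℝ) • h)

theorem rlD_eq_fwdDiff {d : ℕ} (R : ℕ) (h : Euc d) (f : Euc d → ℝ) (x : Euc d) :
    rlD R h f x = (fwdDiff h)^[R] f x := by
  rw [fwdDiff_iter_eq_sum_shift, rlD]
  refine Finset.sum_congr rfl fun j _ => ?_
  simp [Nat.cast_smul_eq_nsmul]

theorem rlD_le {d : ℕ} (R : ℕ) (h : Euc d) (f : Euc d → ℝ) (A : ℝ) (hf : ∀ x, |f x| ≤ A)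
    (x : Euc d) : |rlD R h f x| ≤ 2 ^ R * A := by
  rw [rlD]
  refine (Finset.abs_sum_le_sum_abs _ _).trans ?_
  have h2 : (2 : ℝ) ^ R = ∑ j ∈ Finset.range (R + 1), (R.choose j : ℝ) := by
    exact_mod_cast (Nat.sum_range_choose R).symm
  rw [h2, Finset.sum_mul]
  refine Finset.sum_le_sum fun j _ => ?_
  rw [abs_mul, abs_mul, abs_pow, abs_neg, abs_one, one_pow, one_mul, Nat.abs_cast]
  exact mul_le_mul_of_nonneg_left (hf _) (by positivity)

theorem rl_bump (d R : ℕ) : ∃ Φ : Euc d → ℝ, ∃ C : ℝ, 0 ≤ C ∧ Continuous Φ ∧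
    (∀ x, 0 ≤ Φ x) ∧ (∀ x, Φ x ≤ 1) ∧ (∀ x, ‖x‖ ≤ 1/4 → Φ x = 1) ∧
    (∀ x, 1/2 ≤ ‖x‖ → Φ x = 0) ∧ ∀ x h, |rlD R h Φ x| ≤ C * ‖h‖ ^ R := by
  let b : ContDiffBump (0 : Euc d) := ⟨1/4, 1/2, by norm_num, by norm_num⟩
  obtain ⟨C, hC0, hC⟩ := rl_fwdDiff_bound (E := Euc d) R ℝ b b.contDiff b.hasCompactSupport
  refine ⟨b, C, hC0, b.continuous, fun x => b.nonneg, fun x => b.le_one, ?_, ?_, ?_⟩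
  · intro x hx
    apply b.one_of_mem_closedBall
    simpa [b] using hx
  · intro x hx
    apply b.zero_of_le_dist
    simpa [b] using hx
  · intro x h
    rw [rlD_eq_fwdDiff]
    exact hC x h

theorem rl_filter_card {d : ℕ} {ι : Type} (θ : Finset ι) (z : ι → Euc d)
    (hz : ∀ i j, i ≠ j → 1 ≤ ‖z i - z j‖) (y : Euc d) :
    (θ.filter (fun i => ‖y - z i‖ < 1/2)).card ≤ 1 := by
  rw [Finset.card_le_one]
  intro i hi j hj
  rw [Finset.mem_filter] at hi hj
  by_contra hij
  have h1 := hz i j hij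
  have h2 : z i - z j = (y - z j) - (y - z i) := by abel
  have h3 := norm_sub_le (y - z j) (y - z i)
  rw [← h2] at h3
  linarith [hi.2, hj.2]

theorem rl_G_bounds {d : ℕ} {ι : Type} (θ : Finset ι) (z : ι → Euc d)
    (hz : ∀ i j, i ≠ j → 1 ≤ ‖z i - z j‖) (Φ : Euc d → ℝ)
    (h0 : ∀ x, 0 ≤ Φ x) (h1 : ∀ x, Φ x ≤ 1) (hs : ∀ x, 1/2 ≤ ‖x‖ → Φ x = 0) (y : Euc d) :
    |∑ i ∈ θ, Φ (y - z i)| ≤ 1 := by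
  rw [abs_of_nonneg (Finset.sum_nonneg fun i _ => h0 _)]
  rw [← Finset.sum_filter_of_ne (p := fun i => ‖y - z i‖ < 1/2)]
  · calc _ ≤ (θ.filter (fun i => ‖y - z i‖ < 1/2)).card • (1:ℝ) :=
          Finset.sum_le_card_nsmul _ _ _ (fun i _ => h1 _)
      _ ≤ 1 := by
        have := rl_filter_card θ z hz y
        simpa using this
  · intro i _ hne
    by_contra hlt
    exact hne (hs _ (not_lt.1 hlt))

theorem rl_G_diff {d R : ℕ} {ι : Type} (θ : Finset ι) (z : ι → Euc d)
    (hz : ∀ i j, i ≠ j → 1 ≤ ‖z i - z j‖) (Φ : Euc d → ℝ) (C : ℝ) (hC : 0 ≤ C)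
    (hs : ∀ x, 1/2 ≤ ‖x‖ → Φ x = 0)
    (hΦ : ∀ x h, |rlD R h Φ x| ≤ C * ‖h‖ ^ R) (x h : Euc d) :
    |rlD R h (fun y => ∑ i ∈ θ, Φ (y - z i)) x| ≤ (R + 1) * (C * ‖h‖ ^ R) := by
  have e : rlD R h (fun y => ∑ i ∈ θ, Φ (y - z i)) x = ∑ i ∈ θ, rlD R h Φ (x - z i) := by
    simp only [rlD, Finset.mul_sum]
    rw [Finset.sum_comm]
    refine Finset.sum_congr rfl fun i _ => Finset.sum_congr rfl fun j _ => ?_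
    rw [add_sub_right_comm]
  rw [e]
  set T := (Finset.range (R+1)).biUnion
    (fun j => θ.filter (fun i => ‖(x + (j:ℝ) • h) - z i‖ < 1/2)) with hT
  have hTc : T.card ≤ R + 1 := by
    refine (Finset.card_biUnion_le_card_mul _ _ 1 ?_).trans (by simp)
    intro j _
    exact rl_filter_card θ z hz _
  have hTs : T ⊆ θ := by
    intro i hi
    rw [hT, Finset.mem_biUnion] at hi
    obtain ⟨j, _, hi⟩ := hi
    exact (Finset.mem_filter.1 hi).1
  rw [← Finset.sum_subset hTs]
  · refine (Finset.abs_sum_le_sum_abs _ _).trans ?_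
    refine (Finset.sum_le_card_nsmul _ _ _ (fun i _ => hΦ _ _)).trans ?_
    rw [nsmul_eq_mul]
    have : (T.card : ℝ) ≤ R + 1 := by exact_mod_cast hTc
    exact mul_le_mul_of_nonneg_right this (by positivity)
  · intro i hi hiT
    rw [rlD]
    refine Finset.sum_eq_zero fun j hj => ?_
    rw [hs, mul_zero]
    by_contra hlt
    apply hiT
    rw [hT, Finset.mem_biUnion]
    refine ⟨j, hj, Finset.mem_filter.2 ⟨hi, ?_⟩⟩
    rw [add_sub_right_comm]
    exact not_le.1 hlt

theorem rl_G_diff_beta {d R : ℕ} {ι : Type} (θ : Finset ι) (z : ι → Euc d)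
    (hz : ∀ i j, i ≠ j → 1 ≤ ‖z i - z j‖) (Φ : Euc d → ℝ) (C : ℝ) (hC : 0 ≤ C)
    (h0 : ∀ x, 0 ≤ Φ x) (h1 : ∀ x, Φ x ≤ 1)
    (hs : ∀ x, 1/2 ≤ ‖x‖ → Φ x = 0)
    (hΦ : ∀ x h, |rlD R h Φ x| ≤ C * ‖h‖ ^ R) (β : ℝ) (hβ : 0 < β) (hβR : β ≤ R)
    (x h : Euc d) :
    |rlD R h (fun y => ∑ i ∈ θ, Φ (y - z i)) x| ≤ ((R + 1) * C + 2 ^ R) * ‖h‖ ^ β := by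
  rcases le_total ‖h‖ 1 with hh | hh
  · refine (rl_G_diff θ z hz Φ C hC hs hΦ x h).trans ?_
    have : ‖h‖ ^ R ≤ ‖h‖ ^ β := by
      rw [← Real.rpow_natCast]
      exact Real.rpow_le_rpow_of_exponent_ge' (norm_nonneg _) hh hβ.le hβR
    calc _ = (R + 1) * C * ‖h‖ ^ R := by ring
      _ ≤ (R + 1) * C * ‖h‖ ^ β := by gcongr
      _ ≤ _ := by gcongr; simp
  · refine (rlD_le R h _ 1 (rl_G_bounds θ z hz Φ h0 h1 hs) x).trans ?_
    have h3 : 1 ≤ ‖h‖ ^ β := Real.one_le_rpow hh hβ.le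
    calc (2:ℝ) ^ R * 1 ≤ ((R + 1) * C + 2 ^ R) * 1 := by
          have : 0 ≤ (R + 1) * C := by positivity
          linarith
      _ ≤ _ := by gcongr

theorem rlD_scale {d : ℕ} (R : ℕ) (h : Euc d) (G : Euc d → ℝ) (a μ : ℝ) (c : Euc d) (x : Euc d) :
    rlD R h (fun y => a * G (μ • (y - c))) x = a * rlD R (μ • h) G (μ • (x - c)) := by
  simp only [rlD, Finset.mul_sum]
  refine Finset.sum_congr rfl fun j _ => ?_
  have : μ • (x + (j:ℝ) • h - c) = μ • (x - c) + (j:ℝ) • μ • h := by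
    rw [add_sub_right_comm, smul_add, smul_comm]
  rw [this]; ring

instance rl_prob (d : ℕ) : IsProbabilityMeasure (cubeMeasure d) := by
  have hpre : (WithLp.ofLp : Euc d → (Fin d → ℝ)) ⁻¹' (Set.Icc 0 1) = unitCube d := by
    ext x
    simp [unitCube, Set.mem_Icc, Pi.le_def, forall_and]
  refine ⟨?_⟩
  rw [cubeMeasure, Measure.restrict_apply_univ, ← hpre,
    (PiLp.volume_preserving_ofLp (Fin d)).measure_preimage
      measurableSet_Icc.nullMeasurableSet]
  simp [Real.volume_Icc_pi]

theorem rl_cube_meas (d : ℕ) : MeasurableSet (unitCube d) := by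
  have hpre : (WithLp.ofLp : Euc d → (Fin d → ℝ)) ⁻¹' (Set.Icc 0 1) = unitCube d := by
    ext x
    simp [unitCube, Set.mem_Icc, Pi.le_def, forall_and]
  rw [← hpre]
  exact (WithLp.measurable_ofLp _ _) measurableSet_Icc

theorem rl_pointwise {d : ℕ} (σ : Euc d → ℝ) (R : ℕ) (hR : 1 ≤ R)
    (x0 : Euc d) (ρ : ℝ) (hρ : 0 < ρ) (ε : ℝ) (hε : 0 < ε) (smin : ℝ) (hs : 0 ≤ smin)
    (S : ℝ) (C0 : ℝ) (hC0 : 0 ≤ C0)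
    (hσ0 : ∀ x ∈ unitCube d, 0 ≤ σ x) (hσS : ∀ x ∈ unitCube d, σ x ≤ S) (hS : 0 ≤ S)
    (hloc : ∀ x ∈ unitCube d, ‖x - x0‖ ≤ ρ → σ x ≤ smin + ε) :
    ∃ K : ℝ, 0 < K ∧ ∀ (a μ : ℝ) (f : Euc d → ℝ), 0 ≤ a → 1 ≤ μ → (∀ x, |f x| ≤ a) →
      (∀ x h, |rlD R h f x| ≤ a * C0 * (μ * ‖h‖) ^ (smin + 2 * ε)) →
      (∀ x, f x ≠ 0 → ‖x - x0‖ ≤ ρ / 2) →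
      ∀ (t : ℝ) (h x : Euc d), 0 < t → ‖h‖ ≤ t → x ∈ unitCube d →
        |t ^ (-(σ x)) * rDiff R h f x| ≤ K * (a * μ ^ (smin + 2 * ε)) * (min t 1) ^ ε := by
  set δ : ℝ := min (ρ / (2 * R)) 1 with hδ
  have hRpos : (0:ℝ) < R := by exact_mod_cast hR
  have hδ0 : 0 < δ := lt_min (by positivity) one_pos
  have hδ1 : δ ≤ 1 := min_le_right _ _
  have hδS : 1 ≤ δ ^ (-S) := Real.one_le_rpow_of_pos_of_le_one_of_nonpos hδ0 hδ1 (by linarith)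
  refine ⟨C0 * δ ^ (-S) + 2 ^ R, by positivity, ?_⟩
  intro a μ f ha hμ hfa hfd hfs t h x ht hht hx
  have hμβ : 1 ≤ μ ^ (smin + 2 * ε) := Real.one_le_rpow hμ (by positivity)
  have hmin : 0 < min t 1 := lt_min ht one_pos
  have hrhs : 0 ≤ (C0 * δ ^ (-S) + 2 ^ R) * (a * μ ^ (smin + 2 * ε)) * (min t 1) ^ ε := by
    positivity
  by_cases hcut : x ∈ unitCube d ∧ x + (R : ℝ) • h ∈ unitCube d
  swap
  · rw [rDiff, if_neg hcut, mul_zero, abs_zero]; exact hrhs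
  have hrd : rDiff R h f x = rlD R h f x := by rw [rDiff, if_pos hcut, rlD]
  rw [hrd, abs_mul, abs_of_pos (Real.rpow_pos_of_pos ht _)]
  rcases le_total 1 t with h1t | ht1
  · rw [min_eq_right h1t, Real.one_rpow, mul_one]
    have e1 : t ^ (-(σ x)) ≤ 1 :=
      Real.rpow_le_one_of_one_le_of_nonpos h1t (by linarith [hσ0 x hx])
    have e2 := rlD_le R h f a hfa x
    calc t ^ (-(σ x)) * |rlD R h f x| ≤ 1 * (2 ^ R * a) := by gcongr
      _ = 2 ^ R * (a * 1) := by ring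
      _ ≤ (C0 * δ ^ (-S) + 2 ^ R) * (a * μ ^ (smin + 2 * ε)) := by
        gcongr
        have : 0 ≤ C0 * δ ^ (-S) := by positivity
        linarith
  · rw [min_eq_left ht1]
    rw [min_eq_left ht1] at hrhs
    by_cases hz : rlD R h f x = 0
    · rw [hz, abs_zero, mul_zero]; exact hrhs
    obtain ⟨j, hj, hjf⟩ : ∃ j ∈ Finset.range (R + 1), f (x + (j:ℝ) • h) ≠ 0 := by
      by_contra hcon
      push Not at hcon
      apply hz
      rw [rlD]
      exact Finset.sum_eq_zero fun j hj => by rw [hcon j hj, mul_zero]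
    have hdist : ‖x - x0‖ ≤ ρ / 2 + R * t := by
      have e1 := hfs _ hjf
      have e2 : x - x0 = (x + (j:ℝ) • h - x0) - (j:ℝ) • h := by abel
      rw [e2]
      refine (norm_sub_le _ _).trans (add_le_add e1 ?_)
      rw [norm_smul, Real.norm_natCast]
      have : (j:ℝ) ≤ R := by
        have := Finset.mem_range.1 hj
        exact_mod_cast (by omega : j ≤ R)
      gcongr
    have hw : t ^ (-(σ x)) ≤ δ ^ (-S) * t ^ (-(smin + ε)) := by
      have ht1' : 1 ≤ t ^ (-(smin + ε)) :=
        Real.one_le_rpow_of_pos_of_le_one_of_nonpos ht ht1 (by linarith)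
      rcases le_total t δ with htδ | htδ
      · have : R * t ≤ ρ / 2 := by
          have h3 : t ≤ ρ / (2 * R) := htδ.trans (min_le_left _ _)
          calc R * t ≤ R * (ρ / (2 * R)) := by gcongr
            _ = ρ / 2 := by field_simp
        have hσx := hloc x hx (by linarith)
        calc t ^ (-(σ x)) ≤ t ^ (-(smin + ε)) :=
              Real.rpow_le_rpow_of_exponent_ge ht ht1 (by linarith)
          _ ≤ _ := le_mul_of_one_le_left (by positivity) hδS
      · calc t ^ (-(σ x)) ≤ δ ^ (-(σ x)) :=
              Real.rpow_le_rpow_of_nonpos hδ0 htδ (by linarith [hσ0 x hx])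
          _ ≤ δ ^ (-S) := Real.rpow_le_rpow_of_exponent_ge hδ0 hδ1 (by linarith [hσS x hx])
          _ ≤ _ := le_mul_of_one_le_right (by positivity) ht1'
    have hD : |rlD R h f x| ≤ a * C0 * (μ ^ (smin + 2 * ε) * t ^ (smin + 2 * ε)) := by
      refine (hfd x h).trans ?_
      rw [← Real.mul_rpow (by linarith) ht.le]
      gcongr
    have hcomb : t ^ (-(smin + ε)) * t ^ (smin + 2 * ε) = t ^ ε := by
      rw [← Real.rpow_add ht]; congr 1; ring
    calc t ^ (-(σ x)) * |rlD R h f x|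
        ≤ (δ ^ (-S) * t ^ (-(smin + ε))) * (a * C0 * (μ ^ (smin + 2 * ε) * t ^ (smin + 2 * ε))) := by
          gcongr
      _ = C0 * δ ^ (-S) * (a * μ ^ (smin + 2 * ε)) * (t ^ (-(smin + ε)) * t ^ (smin + 2 * ε)) := by
          ring
      _ = C0 * δ ^ (-S) * (a * μ ^ (smin + 2 * ε)) * t ^ ε := by rw [hcomb]
      _ ≤ _ := by gcongr; linarith [pow_pos (two_pos : (0:ℝ) < 2) R]

theorem rl_eLp {d : ℕ} (p : ℝ≥0∞) (g : Euc d → ℝ) (A : ℝ) (hg : ∀ x ∈ unitCube d, |g x| ≤ A) :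
    eLpNorm g p (cubeMeasure d) ≤ ENNReal.ofReal A := by
  have : ∀ᵐ x ∂(cubeMeasure d), ‖g x‖ ≤ A :=
    ae_restrict_of_forall_mem (rl_cube_meas d) (fun x hx => hg x hx)
  simpa using eLpNorm_le_of_ae_bound (p := p) this

theorem rl_besov {d : ℕ} (p q : ℝ≥0∞) (hq : 0 < q) (σ : Euc d → ℝ) (R : ℕ) (hR : 1 ≤ R)
    (x0 : Euc d) (ρ : ℝ) (hρ : 0 < ρ) (ε : ℝ) (hε : 0 < ε) (smin : ℝ) (hs : 0 ≤ smin)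
    (S : ℝ) (C0 : ℝ) (hC0 : 0 ≤ C0)
    (hσ0 : ∀ x ∈ unitCube d, 0 ≤ σ x) (hσS : ∀ x ∈ unitCube d, σ x ≤ S) (hS : 0 ≤ S)
    (hloc : ∀ x ∈ unitCube d, ‖x - x0‖ ≤ ρ → σ x ≤ smin + ε) :
    ∃ K : ℝ, 0 < K ∧ ∀ (a μ : ℝ) (f : Euc d → ℝ), 0 ≤ a → 1 ≤ μ → (∀ x, |f x| ≤ a) →
      (∀ x h, |rlD R h f x| ≤ a * C0 * (μ * ‖h‖) ^ (smin + 2 * ε)) →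
      (∀ x, f x ≠ 0 → ‖x - x0‖ ≤ ρ / 2) →
      vBesovNormR p q σ R f ≤ ENNReal.ofReal (K * (a * μ ^ (smin + 2 * ε))) := by
  obtain ⟨K1, hK1, hpt⟩ := rl_pointwise σ R hR x0 ρ hρ ε hε smin hs S C0 hC0 hσ0 hσS hS hloc
  have hJ : ∃ K2 : ℝ, 0 ≤ K2 ∧ ∀ (D : ℝ) (f : Euc d → ℝ), 0 ≤ D →
      (∀ t : ℝ, 0 < t → omegaStar p σ R f t ≤ ENNReal.ofReal (D * (min t 1) ^ ε)) →
      vBesovSemi p q σ R f ≤ ENNReal.ofReal (K2 * D) := by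
    by_cases hqt : q = ∞
    · refine ⟨1, zero_le_one, fun D f hD hom => ?_⟩
      rw [vBesovSemi, if_pos hqt]
      refine iSup₂_le fun t ht => (hom t ht).trans ?_
      refine ENNReal.ofReal_le_ofReal ?_
      rw [one_mul]
      refine mul_le_of_le_one_right hD ?_
      exact Real.rpow_le_one (le_min (le_of_lt ht) zero_le_one) (min_le_right _ _) hε.le
    · have hq0 : 0 < q.toReal := ENNReal.toReal_pos hq.ne' hqt
      set J : ℝ≥0∞ := ∫⁻ t in Set.Ioo (0:ℝ) 1, ENNReal.ofReal (t ^ (ε * q.toReal - 1)) with hJd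
      have hJt : J ≠ ∞ := by
        have hi : IntervalIntegrable (fun t : ℝ => t ^ (ε * q.toReal - 1)) volume 0 1 :=
          intervalIntegral.intervalIntegrable_rpow' (by nlinarith [mul_pos hε hq0])
        rw [intervalIntegrable_iff_integrableOn_Ioo_of_le zero_le_one] at hi
        exact (Integrable.lintegral_lt_top hi).ne
      refine ⟨(J ^ (1 / q.toReal)).toReal, ENNReal.toReal_nonneg, fun D f hD hom => ?_⟩
      rw [vBesovSemi, if_neg hqt]
      have hint : (∫⁻ t in Set.Ioo (0 : ℝ) 1,
          (omegaStar p σ R f t) ^ q.toReal * ENNReal.ofReal (1 / t))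
          ≤ ENNReal.ofReal D ^ q.toReal * J := by
        rw [hJd, ← lintegral_const_mul' _ _ (by simp [hq0.le])]
        refine setLIntegral_mono' measurableSet_Ioo fun t ht => ?_
        have e1 := hom t ht.1
        rw [min_eq_left ht.2.le] at e1
        calc (omegaStar p σ R f t) ^ q.toReal * ENNReal.ofReal (1 / t)
            ≤ (ENNReal.ofReal (D * t ^ ε)) ^ q.toReal * ENNReal.ofReal (1 / t) := by gcongr
          _ = _ := by
            have htp : 0 < t := ht.1
            rw [ENNReal.ofReal_mul hD, ENNReal.mul_rpow_of_nonneg _ _ hq0.le, mul_assoc,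
              ENNReal.ofReal_rpow_of_nonneg (Real.rpow_nonneg htp.le ε) hq0.le,
              ← ENNReal.ofReal_mul (by positivity), ← Real.rpow_mul htp.le,
              Real.rpow_sub_one htp.ne']
            congr 3
            ring
      calc _ ≤ (ENNReal.ofReal D ^ q.toReal * J) ^ (1 / q.toReal) := by gcongr
        _ = ENNReal.ofReal D * J ^ (1 / q.toReal) := by
          rw [ENNReal.mul_rpow_of_nonneg _ _ (by positivity), ← ENNReal.rpow_mul,
            mul_one_div_cancel hq0.ne', ENNReal.rpow_one]
        _ = _ := by
          rw [ENNReal.ofReal_mul ENNReal.toReal_nonneg, ENNReal.ofReal_toReal, mul_comm]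
          exact ENNReal.rpow_ne_top_of_nonneg (by positivity) hJt
  obtain ⟨K2, hK2, hsemi⟩ := hJ
  refine ⟨1 + K2 * K1, by positivity, ?_⟩
  intro a μ f ha hμ hfa hfd hfs
  have hμβ : 1 ≤ μ ^ (smin + 2 * ε) := Real.one_le_rpow hμ (by positivity)
  have h1 : eLpNorm f p (cubeMeasure d) ≤ ENNReal.ofReal (a * μ ^ (smin + 2 * ε)) :=
    rl_eLp p f _ (fun x _ => (hfa x).trans (le_mul_of_one_le_right ha hμβ))
  have h2 : vBesovSemi p q σ R f ≤ ENNReal.ofReal (K2 * (K1 * (a * μ ^ (smin + 2 * ε)))) := by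
    refine hsemi _ f (by positivity) fun t ht => ?_
    rw [omegaStar]
    refine iSup₂_le fun h hh => ?_
    exact rl_eLp p _ _ (fun x hx => hpt a μ f ha hμ hfa hfd hfs t h x ht hh hx)
  rw [vBesovNormR]
  refine (add_le_add h1 h2).trans ?_
  rw [← ENNReal.ofReal_add (by positivity) (by positivity)]
  exact ENNReal.ofReal_le_ofReal (by ring_nf; rfl)

theorem rl_avg {d : ℕ} {ι : Type} [Fintype ι] (c : ι → Euc d) (s : ℝ) (hs : 0 < s)
    (hsub : ∀ i, Metric.closedBall (c i) s ⊆ unitCube d)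
    (hdis : ∀ i j, i ≠ j → Disjoint (Metric.closedBall (c i) s) (Metric.closedBall (c j) s))
    (E : Finset ι → Set (Euc d)) (hE : ∀ θ, MeasurableSet (E θ)) (b : ℝ≥0∞)
    (hb : ∀ θ, cubeMeasure d (E θ) ≤ b) :
    ∃ y ∈ Metric.closedBall (0 : Euc d) s,
      (∑ θ : Finset ι, ((Finset.univ.filter (fun i => y + c i ∈ E θ)).card : ℝ≥0∞))
        * volume (Metric.closedBall (0 : Euc d) s) ≤ 2 ^ Fintype.card ι * b := by
  set K := Metric.closedBall (0 : Euc d) s with hK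
  have hK0 : volume K ≠ 0 := (Metric.measure_closedBall_pos volume _ hs).ne'
  have hKt : volume K ≠ ∞ := measure_closedBall_lt_top.ne
  set F : Euc d → ℝ≥0∞ := fun y => ∑ θ : Finset ι, ∑ i : ι,
    Set.indicator ((fun y => y + c i) ⁻¹' (E θ)) 1 y with hF
  have hpm : ∀ θ i, MeasurableSet ((fun y => y + c i) ⁻¹' (E θ)) := fun θ i =>
    (measurable_add_const (c i)) (hE θ)
  have hm : ∀ θ i, Measurable (Set.indicator ((fun y => y + c i) ⁻¹' (E θ)) (1 : Euc d → ℝ≥0∞)) :=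
    fun θ i => measurable_one.indicator (hpm θ i)
  have hFm : Measurable F := by
    refine Finset.measurable_fun_sum _ fun θ _ => Finset.measurable_fun_sum _ fun i _ => hm θ i
  have hint : ∫⁻ y in K, F y ≤ 2 ^ Fintype.card ι * b := by
    rw [hF, lintegral_finsetSum _ (fun θ _ => Finset.measurable_fun_sum _ fun i _ => hm θ i)]
    have : ∀ θ ∈ (Finset.univ : Finset (Finset ι)), ∫⁻ y in K, ∑ i : ι,
        Set.indicator ((fun y => y + c i) ⁻¹' (E θ)) (1 : Euc d → ℝ≥0∞) y ≤ b := by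
      intro θ _
      rw [lintegral_finsetSum _ (fun i _ => hm θ i)]
      have e1 : ∀ i, ∫⁻ y in K, Set.indicator ((fun y => y + c i) ⁻¹' (E θ)) (1 : Euc d → ℝ≥0∞) y
          = volume (Metric.closedBall (c i) s ∩ E θ) := by
        intro i
        rw [lintegral_indicator_one (hpm θ i), Measure.restrict_apply (hpm θ i)]
        have : (fun y => y + c i) ⁻¹' E θ ∩ K
            = (fun y => y + c i) ⁻¹' (Metric.closedBall (c i) s ∩ E θ) := by
          ext y
          simp [hK, and_comm]
        rw [this, measure_preimage_add_right]
      rw [Finset.sum_congr rfl fun i _ => e1 i]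
      rw [← measure_biUnion_finset]
      · refine le_trans ?_ (hb θ)
        rw [cubeMeasure, Measure.restrict_apply (hE θ)]
        refine measure_mono ?_
        intro x hx
        simp only [Set.mem_iUnion] at hx
        obtain ⟨i, _, hx⟩ := hx
        exact ⟨hx.2, hsub i hx.1⟩
      · intro i _ j _ hij
        exact (hdis i j hij).mono Set.inter_subset_left Set.inter_subset_left
      · intro i _
        exact Metric.isClosed_closedBall.measurableSet.inter (hE θ)
    refine (Finset.sum_le_card_nsmul _ _ b this).trans ?_
    simp
  obtain ⟨y, hy, hyF⟩ := exists_le_setLAverage hK0 hKt hFm.aemeasurable.restrict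
  refine ⟨y, hy, ?_⟩
  rw [setLAverage_eq] at hyF
  have hcount : (∑ θ : Finset ι, ((Finset.univ.filter (fun i => y + c i ∈ E θ)).card : ℝ≥0∞))
      = F y := by
    rw [hF]
    refine Finset.sum_congr rfl fun θ _ => ?_
    simp [Set.indicator_apply, Finset.sum_boole]
  rw [hcount]
  refine le_trans ?_ hint
  calc F y * volume K ≤ (∫⁻ a in K, F a) / volume K * volume K := by gcongr
    _ = _ := ENNReal.div_mul_cancel hK0 hKt

/-- integer grid points, shifted by one half -/
def rlz {d m : ℕ} (j : Fin d → Fin m) : Euc d := WithLp.toLp 2 (fun i => ((j i : ℕ) : ℝ) + 1/2)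

theorem rlz_sep {d m : ℕ} (i j : Fin d → Fin m) (hij : i ≠ j) : 1 ≤ ‖rlz i - rlz j‖ := by
  obtain ⟨k, hk⟩ := Function.ne_iff.1 hij
  refine le_trans ?_ (PiLp.norm_apply_le (rlz i - rlz j) k)
  have h1 : ((i k : ℕ) : ℤ) - ((j k : ℕ) : ℤ) ≠ 0 := by
    intro h
    apply hk
    ext
    omega
  have h2 := Int.one_le_abs h1
  have h3 : (1:ℝ) ≤ |((i k : ℕ) : ℝ) - ((j k : ℕ) : ℝ)| := by exact_mod_cast h2
  simpa [rlz] using h3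

theorem rl_geom {d : ℕ} (x0 : Euc d) (hx0 : x0 ∈ unitCube d) (ρ : ℝ) (hρ : 0 < ρ) :
    ∃ (c0 : Euc d) (l : ℝ), 0 < l ∧ l ≤ 1 ∧ ∀ x : Euc d,
      (∀ i, c0 i ≤ x i ∧ x i ≤ c0 i + l) → x ∈ unitCube d ∧ ‖x - x0‖ ≤ ρ / 2 := by
  set l : ℝ := min 1 (ρ / (2 * (d + 1))) with hl
  have hl0 : 0 < l := lt_min one_pos (by positivity)
  have hl1 : l ≤ 1 := min_le_left _ _
  refine ⟨WithLp.toLp 2 (fun i => min (x0 i) (1 - l)), l, hl0, hl1, ?_⟩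
  intro x hx
  simp only at hx
  have hx0' : ∀ i, 0 ≤ x0 i ∧ x0 i ≤ 1 := fun i => hx0 i
  refine ⟨fun i => ?_, ?_⟩
  · have h1 := hx i
    constructor
    · exact le_trans (le_min (hx0' i).1 (by linarith)) h1.1
    · have := min_le_right (x0 i) (1 - l)
      linarith [h1.2]
  · have hc : ∀ i, |x i - x0 i| ≤ l := by
      intro i
      obtain ⟨h1, h2⟩ := hx i
      have h3 := hx0' i
      rw [abs_le]
      rcases le_total (x0 i) (1 - l) with h | h
      · rw [min_eq_left h] at h1 h2
        constructor <;> linarith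
      · rw [min_eq_right h] at h1 h2
        constructor <;> linarith
    have hn : ‖x - x0‖ ≤ (d + 1) * l := by
      rw [EuclideanSpace.norm_eq]
      apply Real.sqrt_le_iff.2
      refine ⟨by positivity, ?_⟩
      calc ∑ i, ‖(x - x0) i‖ ^ 2 ≤ ∑ _i : Fin d, l ^ 2 := by
            refine Finset.sum_le_sum fun i _ => ?_
            have : ‖(x - x0) i‖ ≤ l := by simpa using hc i
            gcongr
        _ = d * l ^ 2 := by simp
        _ ≤ ((d + 1) * l) ^ 2 := by
          rw [mul_pow]
          gcongr
          have : (0:ℝ) ≤ d := by positivity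
          nlinarith
    have h4 : l ≤ ρ / (2 * (d + 1)) := min_le_right _ _
    calc ‖x - x0‖ ≤ (d + 1) * l := hn
      _ ≤ (d + 1) * (ρ / (2 * (d + 1))) := by gcongr
      _ = ρ / 2 := by field_simp

/-- if `x` is in the half ball around the scaled grid point, then it is in the small cube -/
theorem rl_in_Q {d m : ℕ} (c0 : Euc d) (l : ℝ) (hl : 0 < l) (hm : 1 ≤ m) (j : Fin d → Fin m)
    (x : Euc d) (hx : ‖((m : ℝ) / l) • (x - c0) - rlz j‖ ≤ 1/2) :
    ∀ i, c0 i ≤ x i ∧ x i ≤ c0 i + l := by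
  intro i
  have h1 := (PiLp.norm_apply_le (((m : ℝ) / l) • (x - c0) - rlz j) i).trans hx
  have h2 : |(m : ℝ) / l * (x i - c0 i) - (((j i : ℕ) : ℝ) + 1/2)| ≤ 1/2 := by
    simpa [rlz] using h1
  rw [abs_le] at h2
  have hm0 : (0:ℝ) < m := by exact_mod_cast hm
  have hj : ((j i : ℕ) : ℝ) + 1 ≤ m := by exact_mod_cast (j i).2
  have hj0 : (0:ℝ) ≤ ((j i : ℕ) : ℝ) := by positivity
  set u := x i - c0 i with hu
  have h3 : 0 ≤ (m : ℝ) / l * u := by linarith [h2.1]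
  have h4 : (m : ℝ) / l * u ≤ m := by linarith [h2.2]
  have hml : 0 < (m:ℝ) / l := by positivity
  have h5 : 0 ≤ u := nonneg_of_mul_nonneg_right h3 hml
  have h6 : u ≤ l := by
    have : (m : ℝ) / l * u ≤ (m : ℝ) / l * l := by rw [div_mul_cancel₀ _ hl.ne']; exact h4
    exact le_of_mul_le_mul_left this hml
  constructor <;> linarith

/-- the test functions -/
def rlf {d m : ℕ} (Φ : Euc d → ℝ) (c0 : Euc d) (l a : ℝ) (θ : Finset (Fin d → Fin m))
    (x : Euc d) : ℝ :=
  a * ∑ j ∈ θ, Φ (((m : ℝ) / l) • (x - c0) - rlz j)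

theorem rl_avg2 {d : ℕ} {ι : Type} [Fintype ι] (c : ι → Euc d) (s : ℝ) (hs : 0 < s)
    (hsub : ∀ i, Metric.closedBall (c i) s ⊆ unitCube d)
    (hdis : ∀ i j, i ≠ j → Disjoint (Metric.closedBall (c i) s) (Metric.closedBall (c j) s))
    (E : Finset ι → Set (Euc d)) (hE : ∀ θ, MeasurableSet (E θ)) (b : ℝ≥0∞)
    (hb : ∀ θ, cubeMeasure d (E θ) ≤ b) :
    ∃ y ∈ Metric.closedBall (0 : Euc d) s, ∃ T : Finset ι → Finset ι,
      (∀ θ i, y + c i ∈ E θ → i ∈ T θ) ∧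
      (∑ θ : Finset ι, ((T θ).card : ℝ≥0∞))
        * volume (Metric.closedBall (0 : Euc d) s) ≤ 2 ^ Fintype.card ι * b := by
  obtain ⟨y, hy, h⟩ := rl_avg c s hs hsub hdis E hE b hb
  exact ⟨y, hy, _, fun θ i hi => Finset.mem_filter.2 ⟨Finset.mem_univ _, hi⟩, h⟩

theorem rl_comb2 {ι : Type} [Fintype ι] (N : ℕ) (hM : 16 ≤ Fintype.card ι)
    (hN : 16 * N ≤ Fintype.card ι) (P T : Finset ι → Finset ι)
    (hPT : ∀ θ j, (j ∈ θ ∧ j ∉ P θ ∨ j ∈ P θ ∧ j ∉ θ) → j ∈ T θ)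
    (hT : 32 * ∑ θ : Finset ι, (T θ).card ≤ 2 ^ Fintype.card ι * Fintype.card ι) :
    ∃ s : Finset ι, s.card = N + 1 ∧
      ∀ Q : ι → Prop, ∃ θ, ∀ j ∈ s, (j ∈ P θ ↔ Q j) := by
  have h0 : ∑ θ : Finset ι, (symmDiff θ (P θ)).card ≤ ∑ θ : Finset ι, (T θ).card :=
    Finset.sum_le_sum fun θ _ => Finset.card_le_card fun j hj =>
      hPT θ j (Finset.mem_symmDiff.1 hj)
  obtain ⟨s, hs, hsh⟩ := rl_comb N hM hN P ((Nat.mul_le_mul_left _ h0).trans hT)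
  refine ⟨s, hs, fun Q => ?_⟩
  obtain ⟨u, hu, hsu⟩ := hsh (Finset.filter_subset Q s)
  rw [Finset.mem_image] at hu
  obtain ⟨θ, _, rfl⟩ := hu
  refine ⟨θ, fun j hj => ?_⟩
  have := congrArg (fun A => j ∈ A) hsu
  simpa [hj] using this

theorem rl_num (m d M cnt : ℕ) (κ : ℝ) (hκ0 : 0 < κ) (hm0 : (0:ℝ) < m)
    (hsum : (cnt : ℝ≥0∞) * ENNReal.ofReal (κ / (m:ℝ) ^ d) ≤ 2 ^ M * ENNReal.ofReal (κ / 32)) :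
    32 * cnt ≤ 2 ^ M * m ^ d := by
  have e1 : (cnt : ℝ) * (κ / (m:ℝ) ^ d)
      ≤ 2 ^ M * (κ / 32) := by
    have e2 : ENNReal.ofReal ((cnt : ℝ) * (κ / (m:ℝ) ^ d))
        ≤ ENNReal.ofReal (2 ^ M * (κ / 32)) := by
      rw [ENNReal.ofReal_mul (by positivity), ENNReal.ofReal_mul (by positivity),
        ENNReal.ofReal_natCast, ENNReal.ofReal_pow (by norm_num), ENNReal.ofReal_ofNat]
      exact hsum
    exact (ENNReal.ofReal_le_ofReal_iff (by positivity)).1 e2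
  have e3 : (32 : ℝ) * cnt ≤ 2 ^ M * (m:ℝ) ^ d := by
    have hmd : (0:ℝ) < (m:ℝ) ^ d := by positivity
    have : (cnt : ℝ) * (κ / (m:ℝ) ^ d) * (32 * (m:ℝ)^d / κ)
      ≤ 2 ^ M * (κ / 32) * (32 * (m:ℝ)^d / κ) := by gcongr
    have l1 : (cnt : ℝ) * (κ / (m:ℝ) ^ d) * (32 * (m:ℝ)^d / κ) = 32 * cnt := by field_simp
    have l2 : (2:ℝ) ^ M * (κ / 32) * (32 * (m:ℝ)^d / κ)
      = 2 ^ M * (m:ℝ) ^ d := by field_simp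
    rwa [l1, l2] at this
  exact_mod_cast e3

set_option maxHeartbeats 1000000 in
theorem rl_core {d : ℕ} (r : ℝ≥0∞) (hr : 0 < r) (Φ : Euc d → ℝ) (hΦc : Continuous Φ)
    (h1 : ∀ x, ‖x‖ ≤ 1/4 → Φ x = 1) (h0 : ∀ x, 1/2 ≤ ‖x‖ → Φ x = 0)
    (c0 : Euc d) (l : ℝ) (hl : 0 < l)
    (hQ : ∀ x : Euc d, (∀ i, c0 i ≤ x i ∧ x i ≤ c0 i + l) → x ∈ unitCube d) :
    ∃ η : ℝ, 0 < η ∧ ∀ (m N : ℕ) (a : ℝ), 0 < a → 1 ≤ m → 16 ≤ m ^ d → 16 * N ≤ m ^ d →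
      ∀ B : Set (Euc d → ℝ), (∀ g ∈ B, Measurable g) →
        ¬ PseudoShattersOn (unitCube d) B (N + 1) →
        ∃ θ : Finset (Fin d → Fin m), ∀ g ∈ B,
          ENNReal.ofReal (η * a) ≤ eLpNorm (fun x => rlf Φ c0 l a θ x - g x) r (cubeMeasure d) := by
  set v : ℝ≥0∞ := volume (Metric.closedBall (0 : Euc d) 1) with hv
  have hv0 : v ≠ 0 := (Metric.measure_closedBall_pos volume _ one_pos).ne'
  have hvt : v ≠ ∞ := measure_closedBall_lt_top.ne
  set w : ℝ := v.toReal with hw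
  have hw0 : 0 < w := ENNReal.toReal_pos hv0 hvt
  set r1 : ℝ≥0∞ := min r 1 with hr1
  have hr10 : r1 ≠ 0 := (lt_min hr one_pos).ne'
  have hr1t : r1 ≠ ∞ := (lt_of_le_of_lt (min_le_right _ _) ENNReal.one_lt_top).ne
  have hρ0 : 0 < r1.toReal := ENNReal.toReal_pos hr10 hr1t
  set κ : ℝ := (l / 4) ^ d * w with hκ
  have hκ0 : 0 < κ := by positivity
  refine ⟨(κ / 32) ^ (1 / r1.toReal) / 2, by positivity, ?_⟩
  intro m N a ha hm hM hN B hBm hB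
  by_contra hcon
  push Not at hcon
  choose g hgB hg using hcon
  have hm0 : (0:ℝ) < m := by exact_mod_cast hm
  set μ : ℝ := (m:ℝ) / l with hμ
  have hμ0 : 0 < μ := by positivity
  have hcard : Fintype.card (Fin d → Fin m) = m ^ d := by simp
  set c : (Fin d → Fin m) → Euc d := fun j => c0 + μ⁻¹ • rlz j with hc
  have hμc : ∀ (y : Euc d) (i j : Fin d → Fin m), μ • (y + c j - c0) - rlz i = μ • y + (rlz j - rlz i) := by
    intro y i j
    have : y + c j - c0 = y + μ⁻¹ • rlz j := by simp only [hc]; abel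
    rw [this, smul_add, smul_inv_smul₀ hμ0.ne']
    abel
  have hfm : ∀ θ : Finset (Fin d → Fin m), Measurable (rlf Φ c0 l a θ) := by
    intro θ
    refine Continuous.measurable ?_
    unfold rlf
    fun_prop
  set E : Finset (Fin d → Fin m) → Set (Euc d) :=
    fun θ => {x | ENNReal.ofReal (a / 2) ≤ ‖rlf Φ c0 l a θ x - g θ x‖ₑ} with hE
  have hdm : ∀ θ, Measurable (fun x => rlf Φ c0 l a θ x - g θ x) := fun θ =>
    (hfm θ).sub (hBm _ (hgB θ))
  have hEm : ∀ θ, MeasurableSet (E θ) := fun θ =>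
    measurableSet_le measurable_const (hdm θ).enorm
  have hEb : ∀ θ, cubeMeasure d (E θ) ≤ ENNReal.ofReal (κ / 32) := by
    intro θ
    have e1 := meas_ge_le_mul_pow_eLpNorm_enorm (cubeMeasure d) hr10 hr1t
      (hdm θ).aestronglyMeasurable (ε := ENNReal.ofReal (a/2))
      (by simpa using ha) (fun h => absurd h ENNReal.ofReal_ne_top)
    refine e1.trans ?_
    have e2 : eLpNorm (fun x => rlf Φ c0 l a θ x - g θ x) r1 (cubeMeasure d)
        ≤ ENNReal.ofReal ((κ / 32) ^ (1 / r1.toReal) / 2 * a) :=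
      (eLpNorm_le_eLpNorm_of_exponent_le (min_le_left _ _)
        (hdm θ).aestronglyMeasurable).trans (hg θ).le
    calc _ ≤ (ENNReal.ofReal (a/2))⁻¹ ^ r1.toReal *
          (ENNReal.ofReal ((κ / 32) ^ (1 / r1.toReal) / 2 * a)) ^ r1.toReal := by gcongr
      _ = (ENNReal.ofReal ((κ / 32) ^ (1 / r1.toReal))) ^ r1.toReal := by
        rw [← ENNReal.mul_rpow_of_nonneg _ _ hρ0.le, ← ENNReal.ofReal_inv_of_pos (by positivity),
          ← ENNReal.ofReal_mul (by positivity)]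
        congr 2
        field_simp
      _ = ENNReal.ofReal (κ / 32) := by
        rw [ENNReal.ofReal_rpow_of_nonneg (by positivity) hρ0.le, ← Real.rpow_mul (by positivity),
          one_div_mul_cancel hρ0.ne', Real.rpow_one]
      _ ≤ _ := le_rfl
  set s : ℝ := l / 4 / m with hs
  have hs0 : 0 < s := by positivity
  have hμs : μ * s = 1/4 := by rw [hμ, hs]; field_simp
  have hsub : ∀ j, Metric.closedBall (c j) s ⊆ unitCube d := by
    intro j x hx
    refine hQ x (rl_in_Q c0 l hl hm j x ?_)
    have e1 : x = (x - c j) + c j := by abel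
    have e2 := hμc (x - c j) j j
    rw [← e1, sub_self, add_zero] at e2
    rw [e2, norm_smul, Real.norm_of_nonneg hμ0.le]
    rw [mem_closedBall_iff_norm] at hx
    have : μ * ‖x - c j‖ ≤ μ * s := by gcongr
    linarith
  have hdis : ∀ i j, i ≠ j →
      Disjoint (Metric.closedBall (c i) s) (Metric.closedBall (c j) s) := by
    intro i j hij
    refine Metric.closedBall_disjoint_closedBall ?_
    have e1 := rlz_sep i j hij
    have e2 : c i - c j = μ⁻¹ • (rlz i - rlz j) := by simp only [hc, smul_sub]; abel
    rw [dist_eq_norm, e2, norm_smul, norm_inv, Real.norm_of_nonneg hμ0.le]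
    have e3 : s = μ⁻¹ * (1/4) := by rw [← hμs]; field_simp
    have : 0 < μ⁻¹ := by positivity
    rw [e3]
    nlinarith
  obtain ⟨y, hy, T, hT, hsum⟩ := rl_avg2 c s hs0 hsub hdis E hEm _ hEb
  have hμy : ‖μ • y‖ ≤ 1/4 := by
    rw [norm_smul, Real.norm_of_nonneg hμ0.le]
    rw [mem_closedBall_zero_iff] at hy
    have : μ * ‖y‖ ≤ μ * s := by gcongr
    linarith
  have hyc : ∀ j, y + c j ∈ unitCube d := fun j => hsub j (by
    rw [mem_closedBall_iff_norm, add_sub_cancel_right]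
    exact mem_closedBall_zero_iff.1 hy)
  have hfval : ∀ θ j, rlf Φ c0 l a θ (y + c j) = if j ∈ θ then a else 0 := by
    intro θ j
    have e1 : ∀ i, Φ (μ • (y + c j - c0) - rlz i) = if j = i then 1 else 0 := by
      intro i
      rw [hμc]
      split_ifs with hij
      · subst hij
        apply h1
        simpa using hμy
      · apply h0
        have e2 := rlz_sep j i hij
        have e3 := norm_sub_norm_le (rlz j - rlz i) (-(μ • y))
        rw [norm_neg, sub_neg_eq_add, add_comm (rlz j - rlz i)] at e3
        linarith
    rw [rlf, Finset.sum_congr rfl fun i _ => e1 i]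
    simp
  set P : Finset (Fin d → Fin m) → Finset (Fin d → Fin m) :=
    fun θ => Finset.univ.filter (fun j => 0 < g θ (y + c j) + -(a/2)) with hP
  have hPE : ∀ θ j, (j ∈ θ ∧ j ∉ P θ ∨ j ∈ P θ ∧ j ∉ θ) → j ∈ T θ := by
    intro θ j hj
    apply hT
    change ENNReal.ofReal (a / 2) ≤ ‖rlf Φ c0 l a θ (y + c j) - g θ (y + c j)‖ₑ
    rw [hfval, Real.enorm_eq_ofReal_abs]
    refine ENNReal.ofReal_le_ofReal ?_
    simp only [hP, Finset.mem_filter, Finset.mem_univ, true_and] at hj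
    rcases hj with ⟨hj1, hj2⟩ | ⟨hj1, hj2⟩
    · rw [if_pos hj1]
      refine le_trans ?_ (le_abs_self _)
      linarith
    · rw [if_neg hj2]
      refine le_trans ?_ (neg_le_abs _)
      linarith
  have hvol : volume (Metric.closedBall (0 : Euc d) s) = ENNReal.ofReal (κ / (m:ℝ) ^ d) := by
    have e1 := Measure.addHaar_closedBall_mul_of_pos (volume : Measure (Euc d)) 0 hs0 1
    rw [mul_one] at e1
    rw [e1, finrank_euclideanSpace_fin, ← hv, ← ENNReal.ofReal_toReal hvt, ← hw,
      ← ENNReal.ofReal_mul (by positivity), hs, hκ, div_pow (l/4)]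
    congr 1
    ring
  have hfin : 32 * ∑ θ : Finset (Fin d → Fin m), (T θ).card
      ≤ 2 ^ Fintype.card (Fin d → Fin m) * Fintype.card (Fin d → Fin m) := by
    rw [hvol, ← Nat.cast_sum] at hsum
    have e4 := rl_num m d _ _ κ hκ0 hm0 hsum
    rwa [← hcard] at e4
  obtain ⟨S, hSc, hSh⟩ := rl_comb2 N (by rw [hcard]; exact hM) (by rw [hcard]; exact hN) P T
    hPE hfin
  apply hB
  let e : Fin (N + 1) ≃ S := (S.equivFinOfCardEq hSc).symm
  refine ⟨fun k => y + c (e k), fun k => hyc _, fun _ => -(a/2), fun v => ?_⟩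
  obtain ⟨θ, hθ⟩ := hSh (fun j => ∃ k, v k = true ∧ (e k : Fin d → Fin m) = j)
  refine ⟨g θ, hgB θ, fun k => ?_⟩
  have q1 : 0 < g θ (y + c (e k)) + -(a/2) ↔ (e k : Fin d → Fin m) ∈ P θ := by
    simp only [hP, Finset.mem_filter, Finset.mem_univ, true_and]
  rw [q1, hθ _ (e k).2]
  constructor
  · rintro ⟨k', hk', hkk⟩
    have : k' = k := e.injective (Subtype.ext hkk)
    rw [← this]
    exact hk'
  · intro hk
    exact ⟨k, hk, rfl⟩
/-- Theorem 3.5, `ρ_N` part. Let `σ` be log-Hölder continuous with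
attained minimum `s_min > d(1/p − 1/r)_+` on `Ω`. Then for every `ε > 0` there is `C_ε > 0`
such that for all `N ≥ 1` the nonlinear width satisfies
`ρ_N(U_{B^{σ}_{p,q}(Ω)})_{L^r(Ω)} ≥ C_ε N^{−(s_min+ε)/d}`: every set `B` of measurable
functions of pseudo-dimension at most `N` leaves some `f` in the unit ball at `L^r`-distance
at least `C_ε N^{−(s_min+ε)/d}` from `B`. -/
theorem rhoN_lower_bound (d : ℕ) (hd : 1 ≤ d)
    (p q r : ℝ≥0∞) (hp : 0 < p) (hq : 0 < q) (hr : 0 < r)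
    (σ : Euc d → ℝ) (hσlh : LogHolder σ)
    (hσinf : ∃ σ₀ : ℝ, 0 < σ₀ ∧ ∀ x ∈ unitCube d, σ₀ ≤ σ x)
    (smin : ℝ) (hsmin : IsLeast (σ '' unitCube d) smin)
    (hδ : (d : ℝ) * max (1 / p.toReal - 1 / r.toReal) 0 < smin) :
    ∀ ε : ℝ, 0 < ε → ∃ C : ℝ, 0 < C ∧ ∀ N : ℕ, 1 ≤ N →
      ENNReal.ofReal (C * (N : ℝ) ^ (-(smin + ε) / (d : ℝ))) ≤
        ⨅ B ∈ {B : Set (Euc d → ℝ) |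
                (∀ g ∈ B, Measurable g) ∧ ¬ PseudoShattersOn (unitCube d) B (N + 1)},
          ⨆ f ∈ vBesovUnitBall d p q σ,
            ⨅ g ∈ B, eLpNorm (fun x => f x - g x) r (cubeMeasure d) := by
  intro ε hε
  obtain ⟨⟨x0, hx0, hx0s⟩, hlb⟩ := hsmin
  obtain ⟨σ₀, hσ₀, hσlow⟩ := hσinf
  obtain ⟨c, hc, hlh⟩ := hσlh
  have hsmin0 : 0 < smin := by rw [← hx0s]; exact lt_of_lt_of_le hσ₀ (hσlow x0 hx0)
  have hσ0 : ∀ x ∈ unitCube d, 0 ≤ σ x := fun x hx => hσ₀.le.trans (hσlow x hx)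
  have hσS : ∀ x ∈ unitCube d, σ x ≤ smin + c := by
    intro x hx
    by_cases hxx : x = x0
    · rw [hxx, hx0s]; linarith
    have h1 := hlh x hx x0 hx0 hxx
    have hn : 0 < ‖x - x0‖ := norm_pos_iff.2 (sub_ne_zero.2 hxx)
    have h2 : 1 ≤ Real.log (Real.exp 1 + 1 / ‖x - x0‖) := by
      rw [Real.le_log_iff_exp_le (by positivity)]
      have : 0 < 1 / ‖x - x0‖ := by positivity
      linarith
    have h3 : c / Real.log (Real.exp 1 + 1 / ‖x - x0‖) ≤ c := div_le_self hc.le h2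
    rw [hx0s] at h1
    linarith [le_abs_self (σ x - smin)]
  set R := besovR σ with hR
  have hR1 : 1 ≤ R := by rw [hR, besovR]; omega
  have hRs : smin < R := by
    have hb : BddAbove (σ '' unitCube d) := by
      refine ⟨smin + c, ?_⟩
      rintro _ ⟨x, hx, rfl⟩
      exact hσS x hx
    have h1 : smin ≤ sSup (σ '' unitCube d) := le_csSup hb ⟨x0, hx0, hx0s⟩
    have h2 := Nat.lt_floor_add_one (sSup (σ '' unitCube d))
    rw [hR, besovR]
    push_cast
    linarith
  set e : ℝ := min ε (R - smin) / 2 with he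
  have he0 : 0 < e := half_pos (lt_min hε (by linarith))
  have he1 : 2 * e ≤ ε := by
    have := min_le_left ε (R - smin)
    rw [he]; linarith
  have he2 : smin + 2 * e ≤ R := by
    have := min_le_right ε (R - smin)
    rw [he]; linarith
  set ρ : ℝ := Real.exp (-(c / e)) with hρ
  have hρ0 : 0 < ρ := Real.exp_pos _
  have hloc : ∀ x ∈ unitCube d, ‖x - x0‖ ≤ ρ → σ x ≤ smin + e := by
    intro x hx hxr
    by_cases hxx : x = x0
    · rw [hxx, hx0s]; linarith
    have h1 := hlh x hx x0 hx0 hxx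
    have hn : 0 < ‖x - x0‖ := norm_pos_iff.2 (sub_ne_zero.2 hxx)
    have h2 : c / e ≤ Real.log (Real.exp 1 + 1 / ‖x - x0‖) := by
      rw [Real.le_log_iff_exp_le (by positivity)]
      have h3 : 1 / ρ ≤ 1 / ‖x - x0‖ := one_div_le_one_div_of_le hn hxr
      have h4 : 1 / ρ = Real.exp (c / e) := by rw [hρ, Real.exp_neg, one_div, inv_inv]
      linarith [Real.exp_pos 1]
    have h3 : c / Real.log (Real.exp 1 + 1 / ‖x - x0‖) ≤ e := by
      have hce : 0 < c / e := by positivity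
      rw [div_le_iff₀ (by linarith), mul_comm]
      rwa [div_le_iff₀ he0] at h2
    rw [hx0s] at h1
    linarith [le_abs_self (σ x - smin)]
  obtain ⟨Φ, C1, hC1, hΦc, hΦ0, hΦ1, hΦone, hΦz, hΦd⟩ := rl_bump d R
  obtain ⟨c0, l, hl0, hl1, hQ⟩ := rl_geom x0 hx0 ρ hρ0
  obtain ⟨K, hK0, hK⟩ := rl_besov p q hq σ R hR1 x0 ρ hρ0 e he0 smin hsmin0.le (smin + c)
    ((R + 1) * C1 + 2 ^ R) (by positivity) hσ0 hσS (by linarith) hloc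
  obtain ⟨η, hη0, hη⟩ := rl_core r hr Φ hΦc hΦone hΦz c0 l hl0 (fun x hx => (hQ x hx).1)
  set β : ℝ := smin + 2 * e with hβ
  have hβ0 : 0 < β := by positivity
  refine ⟨η * (K⁻¹ * (32 / l) ^ (-β)), by positivity, ?_⟩
  intro N hN
  have hN1 : (1:ℝ) ≤ N := by exact_mod_cast hN
  have hd0 : (0:ℝ) < d := by exact_mod_cast hd
  set n : ℕ := ⌈(N:ℝ) ^ (1 / (d:ℝ))⌉₊ with hn
  have hNd1 : 1 ≤ (N:ℝ) ^ (1 / (d:ℝ)) := Real.one_le_rpow hN1 (by positivity)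
  have hnle : (N:ℝ) ^ (1 / (d:ℝ)) ≤ n := Nat.le_ceil _
  have hnlt : (n:ℝ) < (N:ℝ) ^ (1 / (d:ℝ)) + 1 := Nat.ceil_lt_add_one (by positivity)
  have hnN : N ≤ n ^ d := by
    have h1 : ((N:ℝ) ^ (1 / (d:ℝ))) ^ d ≤ (n:ℝ) ^ d := by gcongr
    rw [← Real.rpow_natCast, ← Real.rpow_mul (by positivity), one_div_mul_cancel hd0.ne',
      Real.rpow_one] at h1
    exact_mod_cast h1
  set m : ℕ := 16 * n with hm
  have hn1 : 1 ≤ n := by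
    have : (1:ℝ) ≤ n := hNd1.trans hnle
    exact_mod_cast this
  have hm1 : 1 ≤ m := by omega
  have hmN : 16 * N ≤ m ^ d := by
    rw [hm, mul_pow]
    exact Nat.mul_le_mul (Nat.le_self_pow (by omega) 16) hnN
  have hm32 : (m:ℝ) ≤ 32 * (N:ℝ) ^ (1 / (d:ℝ)) := by
    rw [hm]; push_cast; linarith
  have hm0 : (0:ℝ) < m := by exact_mod_cast hm1
  set μ : ℝ := (m:ℝ) / l with hμ
  have hμ1 : 1 ≤ μ := by
    rw [hμ, le_div_iff₀ hl0]
    have : (1:ℝ) ≤ m := by exact_mod_cast hm1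
    linarith
  have hμ0 : 0 < μ := by linarith
  set a : ℝ := K⁻¹ * μ ^ (-β) with ha
  have ha0 : 0 < a := by positivity
  have haK : K * (a * μ ^ β) = 1 := by
    rw [ha, Real.rpow_neg hμ0.le]
    field_simp
  refine le_iInf₂ fun B hB => ?_
  obtain ⟨θ, hθ⟩ := hη m N a ha0 hm1 (by omega) hmN B hB.1 hB.2
  have hmem : rlf Φ c0 l a θ ∈ vBesovUnitBall d p q σ := by
    have hsc : rlf Φ c0 l a θ =
        fun y => a * (fun u => ∑ j ∈ θ, Φ (u - rlz j)) (μ • (y - c0)) := rfl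
    have hG := hK a μ (rlf Φ c0 l a θ) ha0.le hμ1 ?_ ?_ ?_
    · rw [haK, ENNReal.ofReal_one] at hG
      exact hG
    · intro x
      rw [hsc]
      simp only
      rw [abs_mul, abs_of_pos ha0]
      exact mul_le_of_le_one_right ha0.le (rl_G_bounds θ rlz rlz_sep Φ hΦ0 hΦ1 hΦz _)
    · intro x h
      have hs2 := rlD_scale R h (fun u => ∑ j ∈ θ, Φ (u - rlz j)) a μ c0 x
      rw [hsc, hs2, abs_mul, abs_of_pos ha0, mul_assoc a (((R:ℝ) + 1) * C1 + 2 ^ R)]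
      refine mul_le_mul_of_nonneg_left ?_ ha0.le
      have h1 := rl_G_diff_beta θ rlz rlz_sep Φ C1 hC1 hΦ0 hΦ1 hΦz hΦd β hβ0 he2
        (μ • (x - c0)) (μ • h)
      rwa [norm_smul, Real.norm_of_nonneg hμ0.le] at h1
    · intro x hx
      rw [rlf] at hx
      obtain ⟨j, _, hj⟩ := Finset.exists_ne_zero_of_sum_ne_zero (right_ne_zero_of_mul hx)
      refine (hQ x (rl_in_Q c0 l hl0 hm1 j x ?_)).2
      by_contra hlt
      exact hj (hΦz _ (not_le.1 hlt).le)
  refine le_trans ?_ (le_iSup₂ (f := fun (f : Euc d → ℝ) (_ : f ∈ vBesovUnitBall d p q σ) =>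
    ⨅ g ∈ B, eLpNorm (fun x => f x - g x) r (cubeMeasure d)) _ hmem)
  refine le_iInf₂ fun g hg => le_trans (ENNReal.ofReal_le_ofReal ?_) (hθ g hg)
  have hμle : μ ≤ 32 / l * (N:ℝ) ^ (1 / (d:ℝ)) := by
    rw [hμ, div_mul_eq_mul_div]
    gcongr
  have hp1 : (32 / l) ^ (-β) * (N:ℝ) ^ (-(smin + ε) / (d:ℝ)) ≤ μ ^ (-β) := by
    calc (32 / l) ^ (-β) * (N:ℝ) ^ (-(smin + ε) / (d:ℝ))
        ≤ (32 / l) ^ (-β) * (N:ℝ) ^ (1 / (d:ℝ) * (-β)) := by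
          gcongr
          rw [div_mul_eq_mul_div, one_mul]
          gcongr
          linarith
      _ = (32 / l * (N:ℝ) ^ (1 / (d:ℝ))) ^ (-β) := by
          rw [Real.mul_rpow (by positivity) (by positivity), ← Real.rpow_mul (by positivity)]
      _ ≤ μ ^ (-β) := Real.rpow_le_rpow_of_nonpos hμ0 hμle (by linarith)
  calc η * (K⁻¹ * (32 / l) ^ (-β)) * (N:ℝ) ^ (-(smin + ε) / (d:ℝ))
      = η * (K⁻¹ * ((32 / l) ^ (-β) * (N:ℝ) ^ (-(smin + ε) / (d:ℝ)))) := by ring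
    _ ≤ η * (K⁻¹ * μ ^ (-β)) := by gcongr
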